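/- arXiv:1702.03356 — 2 statements merged into one kernel-verified Lean document; each statement's English description precedes it below -/
import Mathlib

section
/- Let K be an infinite field and A a finite-dimensional K-algebra. Then A is isomorphic as a K-algebra to the incidence algebra I(Q,K) of some finite preorder Q if and only if the following three conditions hold: (i) A has a faithful finite-dimensional distributive module; (ii) for every simple A-module S, every A-module endomorphism of S is multiplication by a scalar from K; (iii) for every two-sided ideal I of A, the center of the quotient ring A/I is isomorphic as a K-algebra to Kᵐ for some natural number m. -/
/-!
STATEMENT 15 (Feinberg): Let `K` be an infinite field and `A` a finite-dimensional
`K`-algebra.  Then `A` is isomorphic as a `K`-algebra to the incidence algebra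
`I(Q,K)` of some finite preorder `Q` if and only if:
(i) `A` has a faithful finite-dimensional distributive module;
(ii) every endomorphism of every simple `A`-module is multiplication by a scalar
     from `K`;
(iii) for every two-sided ideal `I` of `A`, the center of `A/I` is isomorphic as a
      `K`-algebra to `Kᵐ` for some `m`.

Since Mathlib's `Algebra` instance on incidence algebras is only stated for partial
orders, the `K`-algebra isomorphism with `I(Q,K)` for a preorder `Q` is rendered as a
`K`-linear ring isomorphism.
-/

universe u v

theorem exists_surjective_pi_matrix_of_forall_end_eq_smul
    (K : Type u) [Field K] (A : Type v) [Ring A] [Algebra K A] [FiniteDimensional K A]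
    (h : ∀ (S : Type v) [AddCommGroup S] [Module A S], IsSimpleModule A S →
      ∀ φ : S →ₗ[A] S, ∃ c : K, ∀ x : S, φ x = algebraMap K A c • x) :
    ∃ (n : ℕ) (d : Fin n → ℕ) (π : A →ₐ[K] Π i, Matrix (Fin (d i)) (Fin (d i)) K),
      Function.Surjective π ∧ IsNilpotent (RingHom.ker π) := by
  have : IsArtinianRing A := IsArtinianRing.of_finite K A
  obtain ⟨n, S, d, hS, -, ⟨e⟩⟩ :=
    IsSemisimpleRing.exists_algEquiv_pi_matrix_end_mulOpposite K (A ⧸ Ring.jacobson A)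
  have hbij (i : Fin n) : Function.Bijective
      (Algebra.ofId K (Module.End (A ⧸ Ring.jacobson A) (S i))ᵐᵒᵖ) := by
    have := hS i
    have := IsSimpleModule.nontrivial (A ⧸ Ring.jacobson A) (S i)
    refine ⟨RingHom.injective _, fun f ↦ ?_⟩
    let q := Ideal.Quotient.mk (Ring.jacobson A)
    let _ : Module A (S i) := Module.compHom _ q
    have hq (a : A) (x : S i) : a • x = q a • x := rfl
    have hsimple : IsSimpleModule A (S i) := by
      rw [isSimpleModule_iff_toSpanSingleton_surjective]
      refine ⟨inferInstance, fun m hm y ↦ ?_⟩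
      obtain ⟨r, hr⟩ := IsSimpleModule.toSpanSingleton_surjective (A ⧸ Ring.jacobson A) hm y
      obtain ⟨a, rfl⟩ := Ideal.Quotient.mk_surjective r
      exact ⟨a, hr⟩
    let φ : S i →ₗ[A] S i :=
      { toFun := f.unop, map_add' := map_add _, map_smul' := fun a x ↦ map_smul f.unop (q a) x }
    obtain ⟨c, hc⟩ := h (S i) hsimple φ
    refine ⟨c, MulOpposite.unop_injective (LinearMap.ext fun x ↦ ?_)⟩
    refine Eq.trans ?_ (hc x).symm
    rw [Algebra.ofId_apply, MulOpposite.algebraMap_apply, MulOpposite.unop_op,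
      Module.algebraMap_end_apply]
    exact algebra_compatible_smul (A ⧸ Ring.jacobson A) c x
  let E : (Π i, Matrix (Fin (d i)) (Fin (d i)) (Module.End (A ⧸ Ring.jacobson A) (S i))ᵐᵒᵖ) ≃ₐ[K]
      Π i, Matrix (Fin (d i)) (Fin (d i)) K :=
    AlgEquiv.piCongrRight fun i ↦ ((AlgEquiv.ofBijective _ (hbij i)).symm).mapMatrix
  let ψ := e.trans E
  refine ⟨n, d, ψ.toAlgHom.comp (Ideal.Quotient.mkₐ K (Ring.jacobson A)),
    ψ.surjective.comp Ideal.Quotient.mk_surjective, ?_⟩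
  have hker : RingHom.ker (ψ.toAlgHom.comp (Ideal.Quotient.mkₐ K (Ring.jacobson A))) =
      Ring.jacobson A := by
    ext a
    simp [RingHom.mem_ker, Ideal.Quotient.eq_zero_iff_mem]
  rw [hker]
  exact IsSemiprimaryRing.isNilpotent

theorem Pi.mul_single_matrix_single {K ι : Type*} [Semiring K] [DecidableEq ι] {d : ι → Type*}
    [∀ i, Fintype (d i)] [∀ i, DecidableEq (d i)] (p : Π i, Matrix (d i) (d i) K)
    (i : ι) (b j : d i) :
    p * Pi.single i (Matrix.single b j 1) = ∑ c, p i c b •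
      (Pi.single i (Matrix.single c j 1) : Π i, Matrix (d i) (d i) K) := by
  ext i' x y
  obtain rfl | h := eq_or_ne i' i
  · simp [Matrix.mul_apply, Matrix.sum_apply, Matrix.single_apply, ite_and]
  · simp [Matrix.mul_apply, Matrix.sum_apply, h]

theorem Pi.single_matrix_single_mul {K ι : Type*} [Semiring K] [DecidableEq ι] {d : ι → Type*}
    [∀ i, Fintype (d i)] [∀ i, DecidableEq (d i)] (p : Π i, Matrix (d i) (d i) K)
    (i : ι) (j b : d i) :
    Pi.single i (Matrix.single j b 1) * p = ∑ c, p i b c •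
      (Pi.single i (Matrix.single j c 1) : Π i, Matrix (d i) (d i) K) := by
  ext i' x y
  obtain rfl | h := eq_or_ne i' i
  · simp [Matrix.mul_apply, Matrix.sum_apply, Matrix.single_apply, ite_and]
  · simp [Matrix.mul_apply, Matrix.sum_apply, h]

theorem mem_pow_succ_of_corner {K : Type*} [Field K] {A : Type*} [Ring A] [Algebra K A]
    (hred : ∀ I : Ideal A, I.IsTwoSided →
      ∀ z : A, (∀ a, a * z - z * a ∈ I) → z * z ∈ I → z ∈ I)
    {ι : Type*} [DecidableEq ι] {d : ι → Type*} [∀ i, Fintype (d i)] [∀ i, DecidableEq (d i)]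
    (π : A →ₐ[K] Π i, Matrix (d i) (d i) K) (hπ : Function.Surjective π)
    {i : ι} {j : d i} {e : A} (he : π e = Pi.single i (Matrix.single j j 1))
    {k : ℕ} (hk : 1 ≤ k) {z : A} (hz : e * z * e = z) (hzk : z ∈ RingHom.ker π ^ k) :
    z ∈ RingHom.ker π ^ (k + 1) := by
  set J := RingHom.ker π with hJ
  choose u hu using fun b : d i ↦ hπ (Pi.single i (Matrix.single b j 1))
  choose v hv using fun b : d i ↦ hπ (Pi.single i (Matrix.single j b 1))
  have hleft {a a' s : A} (h : π a = π a') (hs : s ∈ J ^ k) : a * s - a' * s ∈ J ^ (k + 1) := by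
    rw [← sub_mul, Ideal.IsTwoSided.pow_succ]
    exact Ideal.mul_mem_mul (by rw [hJ, RingHom.mem_ker, map_sub, h, sub_self]) hs
  have hright {a a' s : A} (h : π a = π a') (hs : s ∈ J ^ k) : s * a - s * a' ∈ J ^ (k + 1) := by
    rw [← mul_sub, Submodule.pow_succ]
    exact Ideal.mul_mem_mul hs (by rw [hJ, RingHom.mem_ker, map_sub, h, sub_self])
  set ζ := ∑ b, u b * z * v b with hζ
  have hmid (b) : u b * z ∈ J ^ k := Ideal.mul_mem_left _ _ hzk
  have hmid' (b) : z * v b ∈ J ^ k := Ideal.mul_mem_right _ _ hzk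
  have hζk : ζ ∈ J ^ k := sum_mem fun b _ ↦ Ideal.mul_mem_right _ _ (hmid b)
  have hζmem : ζ ∈ J ^ (k + 1) := by
    refine hred _ inferInstance ζ (fun a ↦ ?_) ?_
    · set p := π a i with hp
      have h1 : a * ζ - ∑ b, ∑ c, p c b • (u c * z * v b) ∈ J ^ (k + 1) := by
        rw [hζ, Finset.mul_sum, ← Finset.sum_sub_distrib]
        refine sum_mem fun b _ ↦ ?_
        have : π (a * u b) = π (∑ c, p c b • u c) := by
          rw [map_mul, hu, map_sum]
          simp only [map_smul, hu]
          exact Pi.mul_single_matrix_single _ _ _ _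
        have := hleft this (hmid' b)
        simpa [Finset.sum_mul, mul_assoc] using this
      have h2 : ζ * a - ∑ b, ∑ c, p b c • (u b * z * v c) ∈ J ^ (k + 1) := by
        rw [hζ, Finset.sum_mul, ← Finset.sum_sub_distrib]
        refine sum_mem fun b _ ↦ ?_
        have : π (v b * a) = π (∑ c, p b c • v c) := by
          rw [map_mul, hv, map_sum]
          simp only [map_smul, hv]
          exact Pi.single_matrix_single_mul _ _ _ _
        have := hright this (hmid b)
        simpa [Finset.mul_sum, mul_assoc] using this
      rw [Finset.sum_comm] at h2
      simpa using sub_mem h1 h2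
    · refine Ideal.pow_le_pow_right (by lia : k + 1 ≤ k + k) ?_
      rw [Ideal.IsTwoSided.pow_add]
      exact Ideal.mul_mem_mul hζk hζk
  have h3 : e * ζ * e - z ∈ J ^ (k + 1) := by
    have h5 (b) : e * (u b * z * v b) * e - (if b = j then z else 0) ∈ J ^ (k + 1) := by
      have hl : π (e * u b) = π (if b = j then e else 0) := by
        rw [map_mul, he, hu, ← Pi.single_mul]
        obtain rfl | h := eq_or_ne b j
        · simp [he]
        · simp [h, h.symm]
      have hr : π (v b * e) = π (if b = j then e else 0) := by
        rw [map_mul, he, hv, ← Pi.single_mul]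
        obtain rfl | h := eq_or_ne b j
        · simp [he]
        · simp [h]
      have h6 := add_mem (hleft hl (Ideal.mul_mem_right (v b * e) _ hzk))
        (Ideal.mul_mem_left _ (if b = j then e else 0) (hright hr hzk))
      obtain rfl | h := eq_or_ne b j
      · simpa only [if_true, mul_sub, ← mul_assoc, hz, sub_add_sub_cancel] using h6
      · simpa [h, mul_assoc] using h6
    have h6 := sum_mem fun b (_ : b ∈ Finset.univ) ↦ h5 b
    simpa [Finset.mul_sum, Finset.sum_mul, hζ] using h6
  have h4 : e * ζ * e ∈ J ^ (k + 1) := Ideal.mul_mem_right _ _ (Ideal.mul_mem_left _ _ hζmem)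
  simpa using sub_mem h4 h3

theorem eq_zero_of_corner {K : Type*} [Field K] {A : Type*} [Ring A] [Algebra K A]
    (hred : ∀ I : Ideal A, I.IsTwoSided →
      ∀ z : A, (∀ a, a * z - z * a ∈ I) → z * z ∈ I → z ∈ I)
    {ι : Type*} [DecidableEq ι] {d : ι → Type*} [∀ i, Fintype (d i)] [∀ i, DecidableEq (d i)]
    (π : A →ₐ[K] Π i, Matrix (d i) (d i) K) (hπ : Function.Surjective π)
    (hnil : IsNilpotent (RingHom.ker π))
    {i : ι} {j : d i} {e : A} (he : π e = Pi.single i (Matrix.single j j 1))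
    {z : A} (hz : e * z * e = z) (hz0 : π z = 0) : z = 0 := by
  obtain ⟨N, hN⟩ := hnil
  have key (k : ℕ) : z ∈ RingHom.ker π ^ (k + 1) := by
    induction k with
    | zero => simpa [Submodule.pow_one] using hz0
    | succ k ih => exact mem_pow_succ_of_corner hred π hπ he (Nat.le_add_left 1 k) hz ih
  have := Ideal.pow_le_pow_right (Nat.le_succ N) (key N)
  simpa [hN] using this

theorem exists_completeOrthogonalIdempotents_corner {K : Type*} [Field K] {A : Type*} [Ring A]
    [Algebra K A]
    (hred : ∀ I : Ideal A, I.IsTwoSided →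
      ∀ z : A, (∀ a, a * z - z * a ∈ I) → z * z ∈ I → z ∈ I)
    {ι : Type*} [Fintype ι] [DecidableEq ι] {d : ι → Type*} [∀ i, Fintype (d i)]
    [∀ i, DecidableEq (d i)]
    (π : A →ₐ[K] Π i, Matrix (d i) (d i) K) (hπ : Function.Surjective π)
    (hnil : IsNilpotent (RingHom.ker π)) :
    ∃ e : (Σ i, d i) → A, CompleteOrthogonalIdempotents e ∧ (∀ x, e x ≠ 0) ∧
      ∀ x a, ∃ c : K, e x * a * e x = c • e x := by
  let E : (Σ i, d i) → Π i, Matrix (d i) (d i) K :=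
    fun x ↦ Pi.single x.1 (Matrix.single x.2 x.2 1)
  have hE : CompleteOrthogonalIdempotents E := by
    refine ⟨⟨fun x ↦ ?_, fun x y hxy ↦ ?_⟩, ?_⟩
    · simp [E, IsIdempotentElem, ← Pi.single_mul]
    · obtain ⟨i, x⟩ := x
      obtain ⟨j, y⟩ := y
      obtain rfl | h := eq_or_ne i j
      · have : x ≠ y := by rintro rfl; exact hxy rfl
        simp [E, ← Pi.single_mul, this]
      · ext k
        obtain rfl | h' := eq_or_ne k i <;> simp [E, *]
    · rw [Fintype.sum_sigma]
      ext i x y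
      simp [E, Matrix.sum_apply, Matrix.one_apply]
      rw [Finset.sum_eq_single i (fun j _ h ↦ by simp [h.symm]) (by simp)]
      simp [Matrix.single_apply, ite_and]
  have hJ : ∀ x ∈ RingHom.ker (π : A →+* Π i, Matrix (d i) (d i) K), IsNilpotent x := by
    obtain ⟨N, hN⟩ := hnil
    refine fun x hx ↦ ⟨N, ?_⟩
    have := Ideal.pow_mem_pow (I := RingHom.ker π) hx N
    simpa [hN] using this
  obtain ⟨e, he, heE⟩ := CompleteOrthogonalIdempotents.lift_of_isNilpotent_ker
    (π : A →+* Π i, Matrix (d i) (d i) K) hJ hE fun x ↦ hπ _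
  have hπe (x) : π (e x) = E x := congr_fun heE x
  refine ⟨e, he, fun x hx ↦ ?_, fun x a ↦ ⟨π a x.1 x.2 x.2, ?_⟩⟩
  · have := congr_fun₂ (congr_fun ((hπe x).symm.trans (by rw [hx, map_zero])) x.1) x.2 x.2
    simp [E] at this
  · rw [← sub_eq_zero]
    refine eq_zero_of_corner hred π hπ hnil (hπe x) ?_ ?_
    · have := (he.idem x).eq
      simp only [mul_sub, sub_mul, mul_smul_comm, smul_mul_assoc, this, sub_left_inj]
      rw [← mul_assoc, ← mul_assoc, this, mul_assoc, this]
    · simp only [map_sub, map_mul, map_smul, hπe, E, sub_eq_zero]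
      ext i y z
      obtain rfl | h := eq_or_ne i x.1
      · simp [Matrix.single_apply, Matrix.mul_apply, ite_and]
        split_ifs <;> rfl
      · simp [h]

theorem mem_of_center_quotient_algEquiv_pi {K : Type*} [Field K] {A : Type*} [Ring A] [Algebra K A]
    (I : TwoSidedIdeal A) {m : ℕ}
    (f : Subalgebra.center K I.ringCon.Quotient ≃ₐ[K] (Fin m → K))
    {z : A} (hz : ∀ a, a * z - z * a ∈ I) (hz2 : z * z ∈ I) : z ∈ I := by
  have hq {a b : A} : (a : I.ringCon.Quotient) = b ↔ a - b ∈ I :=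
    (RingCon.eq _).trans (I.rel_iff a b)
  have hq0 {a : A} : (a : I.ringCon.Quotient) = 0 ↔ a ∈ I := by
    rw [← RingCon.coe_zero, hq, sub_zero]
  let ζ : Subalgebra.center K I.ringCon.Quotient := ⟨(z : I.ringCon.Quotient), by
    rw [Subalgebra.mem_center_iff]
    intro b
    obtain ⟨a, rfl⟩ := RingCon.mk'_surjective I.ringCon b
    exact hq.2 (hz a)⟩
  have hζ : ζ * ζ = 0 := Subtype.ext (hq0.2 hz2)
  have hfζ : f ζ = 0 := by
    have : f ζ * f ζ = 0 := by rw [← map_mul, hζ, map_zero]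
    exact funext fun i ↦ mul_self_eq_zero.1 (congr_fun this i)
  have : ζ = 0 := by simpa using hfζ
  exact hq0.1 (congr_arg Subtype.val this)

theorem exists_smul_eq_of_distributive {K : Type*} [Field K] {A : Type*} [Ring A] [Algebra K A]
    {M : Type*} [AddCommGroup M] [Module K M] [Module A M] [IsScalarTower K A M]
    (hM : ∀ N L L' : Submodule A M, N ⊓ (L ⊔ L') = (N ⊓ L) ⊔ (N ⊓ L'))
    {e : A} (he : ∀ a, ∃ c : K, e * a * e = c • e) {u v : M} (hu : e • u = u) (hv : e • v = v)
    (hu0 : u ≠ 0) : ∃ c : K, v = c • u := by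
  have hscal {w : M} (hw : e • w = w) (a : A) : ∃ c : K, e • a • w = c • w := by
    obtain ⟨c, hc⟩ := he a
    refine ⟨c, ?_⟩
    nth_rw 1 [← hw]
    rw [← mul_smul, ← mul_smul, hc, smul_assoc, hw]
  have huv : e • (u + v) = u + v := by rw [smul_add, hu, hv]
  have hmem : u + v ∈ (A ∙ (u + v)) ⊓ ((A ∙ u) ⊔ (A ∙ v)) :=
    ⟨Submodule.mem_span_singleton_self _, Submodule.add_mem_sup
      (Submodule.mem_span_singleton_self _) (Submodule.mem_span_singleton_self _)⟩
  rw [hM, Submodule.mem_sup] at hmem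
  obtain ⟨p, ⟨hp, hp'⟩, q, ⟨hq, hq'⟩, hpq⟩ := hmem
  simp only [SetLike.mem_coe, Submodule.mem_span_singleton] at hp hp' hq hq'
  have hkey {w p : M} (hw : e • w = w) (hp : ∃ a : A, a • w = p) : ∃ c : K, e • p = c • w := by
    obtain ⟨a, rfl⟩ := hp
    exact hscal hw a
  obtain ⟨c, hc⟩ := hkey huv hp
  obtain ⟨c', hc'⟩ := hkey hu hp'
  obtain ⟨d, hd⟩ := hkey huv hq
  obtain ⟨d', hd'⟩ := hkey hv hq'
  have hsum : (c + d) • (u + v) = u + v := by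
    rw [add_smul, ← hc, ← hd, ← smul_add, hpq, huv]
  by_cases hc0 : c = 0
  · have h1 : d • (u + v) = u + v := by simpa [hc0] using hsum
    have h2 : u = (d' - 1) • v := by
      rw [sub_smul, one_smul, ← hd', hd, h1, add_sub_cancel_right]
    have h3 : d' - 1 ≠ 0 := by
      rintro h
      exact hu0 (by rw [h2, h, zero_smul])
    exact ⟨(d' - 1)⁻¹, by rw [h2, smul_smul, inv_mul_cancel₀ h3, one_smul]⟩
  · refine ⟨c⁻¹ * c' - 1, ?_⟩
    rw [sub_smul, mul_smul, ← hc', hc, smul_smul, inv_mul_cancel₀ hc0, one_smul, one_smul,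
      add_sub_cancel_left]

theorem exists_incidenceAlgebra_equiv {K : Type u} [Field K] {A : Type v} [Ring A] [Algebra K A]
    {Q : Type} [Fintype Q] {e : Q → A} (he : CompleteOrthogonalIdempotents e)
    {M : Type*} [AddCommGroup M] [Module K M] [Module A M] [IsScalarTower K A M] [FaithfulSMul A M]
    {m : Q → M} (hm0 : ∀ x, m x ≠ 0) (hem : ∀ x, e x • m x = m x)
    (hm : ∀ x w, e x • w = w → ∃ c : K, w = c • m x) :
    ∃ (_ : Preorder Q) (_ : DecidableEq Q)
      (_ : LocallyFiniteOrder Q) (f : A ≃+* IncidenceAlgebra K Q),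
        ∀ (c : K) (a : A), f (c • a) = c • f a := by
  classical
  have hex (a : A) (x y : Q) : ∃ c : K, e x • a • m y = c • m x :=
    hm x _ (by rw [← mul_smul, (he.idem x).eq])
  choose ρ hρ using hex
  have huniq {a : A} {x y : Q} {c : K} (h : e x • a • m y = c • m x) : ρ a x y = c :=
    smul_left_injective K (hm0 x) ((hρ a x y).symm.trans h)
  have hsum (w : M) : ∑ x, e x • w = w := by rw [← Finset.sum_smul, he.complete, one_smul]
  have hexp (a : A) (y : Q) : a • m y = ∑ x, ρ a x y • m x := by
    rw [← hsum (a • m y)]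
    simp only [hρ]
  have hem0 {x y : Q} (h : x ≠ y) : e x • m y = 0 := by
    rw [← hem y, ← mul_smul, he.ortho h, zero_smul]
  have hmul (a b : A) (x z : Q) : ρ (a * b) x z = ∑ y, ρ a x y * ρ b y z := by
    refine huniq ?_
    rw [mul_smul, hexp b, Finset.smul_sum, Finset.smul_sum, Finset.sum_smul]
    refine Finset.sum_congr rfl fun y _ ↦ ?_
    rw [smul_algebra_smul_comm, smul_algebra_smul_comm, hρ, smul_smul, mul_comm]
  have hadd (a b : A) (x y : Q) : ρ (a + b) x y = ρ a x y + ρ b x y :=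
    huniq (by rw [add_smul, smul_add, hρ, hρ, add_smul])
  have hsmul (c : K) (a : A) (x y : Q) : ρ (c • a) x y = c * ρ a x y :=
    huniq (by rw [smul_assoc, smul_algebra_smul_comm, hρ, smul_smul])
  have he_apply (x y z : Q) : ρ (e x) y z = if x = y ∧ x = z then 1 else 0 := by
    refine huniq ?_
    by_cases hxz : x = z
    · subst hxz
      rw [hem]
      by_cases hxy : x = y
      · subst hxy
        simp [hem]
      · simp [hxy, hem0 (Ne.symm hxy)]
    · simp [hxz, hem0 hxz]
  have hcorner (a : A) (x y z w : Q) :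
      ρ (e x * a * e y) z w = if x = z ∧ y = w then ρ a x y else 0 := by
    simp only [hmul, he_apply, ite_and, Finset.sum_mul]
    simp
    split_ifs <;> rfl
  let _ : Preorder Q :=
    { le := fun x y ↦ ∃ a, ρ a x y ≠ 0
      le_refl := fun x ↦ ⟨e x, by simp [he_apply]⟩
      le_trans := fun x y z ⟨a, ha⟩ ⟨b, hb⟩ ↦ ⟨a * e y * b, by
        simp only [hmul, he_apply, ite_and]
        simp [ha, hb]⟩ }
  let _ : LocallyFiniteOrder Q := LocallyFiniteOrder.ofIcc' Q
    (fun x y ↦ Finset.univ.filter fun z ↦ x ≤ z ∧ z ≤ y) fun x y z ↦ by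
      rw [Finset.mem_filter_univ]
  let f : A →+* IncidenceAlgebra K Q :=
    { toFun := fun a ↦ ⟨ρ a, fun x y h ↦ by_contra fun h' ↦ h ⟨a, h'⟩⟩
      map_one' := by
        ext x y -
        refine huniq ?_
        obtain rfl | h := eq_or_ne x y
        · simp [hem]
        · simp [h, hem0 h]
      map_mul' := fun a b ↦ by
        ext x y -
        rw [IncidenceAlgebra.mul_apply]
        refine (hmul a b x y).trans (Finset.sum_subset (Finset.subset_univ _) fun z _ hz ↦ ?_).symm
        by_contra h
        exact hz (Finset.mem_Icc.2 ⟨⟨a, left_ne_zero_of_mul h⟩, ⟨b, right_ne_zero_of_mul h⟩⟩)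
      map_zero' := by
        ext x y -
        exact huniq (by simp)
      map_add' := fun a b ↦ by
        ext x y -
        exact hadd a b x y }
  have hf (a : A) (x y : Q) : f a x y = ρ a x y := rfl
  have hinj : Function.Injective f := by
    rw [injective_iff_map_eq_zero]
    refine fun a ha ↦ eq_of_smul_eq_smul fun w : M ↦ ?_
    have ham (y : Q) : a • m y = 0 := by
      rw [hexp]
      exact Finset.sum_eq_zero fun x _ ↦ by rw [← hf, ha, IncidenceAlgebra.zero_apply, zero_smul]
    rw [zero_smul, ← hsum w, Finset.smul_sum]
    refine Finset.sum_eq_zero fun x _ ↦ ?_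
    obtain ⟨c, hc⟩ := hm x (e x • w) (by rw [← mul_smul, (he.idem x).eq])
    rw [hc, smul_algebra_smul_comm, ham, smul_zero]
  have hsurj : Function.Surjective f := by
    intro g
    have hunit (x y : Q) : ∃ b : A, ∀ z w, ρ b z w = if x = z ∧ y = w then g x y else 0 := by
      by_cases hxy : x ≤ y
      · obtain ⟨a, ha⟩ := hxy
        refine ⟨(g x y * (ρ a x y)⁻¹) • (e x * a * e y), fun z w ↦ ?_⟩
        rw [hsmul, hcorner, mul_ite, mul_zero, inv_mul_cancel_right₀ ha]
      · exact ⟨0, fun z w ↦ huniq (by simp [IncidenceAlgebra.apply_eq_zero_of_not_le hxy])⟩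
    choose b hb using hunit
    refine ⟨∑ x, ∑ y, b x y, ?_⟩
    ext z w -
    let φ : A →+ K := AddMonoidHom.mk' (fun a ↦ ρ a z w) fun a b ↦ hadd a b z w
    have hφ (x y) : φ (b x y) = if x = z ∧ y = w then g x y else 0 := hb x y z w
    change φ _ = _
    simp [map_sum, hφ, ite_and]
  exact ⟨inferInstance, inferInstance, inferInstance, RingEquiv.ofBijective f ⟨hinj, hsurj⟩,
    fun c a ↦ by ext x y -; exact hsmul c a x y⟩

theorem exists_end_eq_smul_of_corner {K : Type*} [Field K] {A : Type*} [Ring A] [Algebra K A]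
    {Q : Type*} [Fintype Q] {ε : Q → A} (hε : CompleteOrthogonalIdempotents ε)
    (hc : ∀ x a, ∃ c : K, ε x * a * ε x = c • ε x)
    {S : Type*} [AddCommGroup S] [Module A S] [IsSimpleModule A S] (φ : S →ₗ[A] S) :
    ∃ c : K, ∀ s : S, φ s = algebraMap K A c • s := by
  have := IsSimpleModule.nontrivial A S
  obtain ⟨s₀, hs₀⟩ := exists_ne (0 : S)
  obtain ⟨x, hx⟩ : ∃ x, ε x • s₀ ≠ 0 := by
    by_contra! h
    refine hs₀ ?_
    rw [← one_smul A s₀, ← hε.complete, Finset.sum_smul]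
    exact Finset.sum_eq_zero fun x _ ↦ h x
  obtain ⟨a, ha⟩ := IsSimpleModule.toSpanSingleton_surjective A hx (φ (ε x • s₀))
  rw [LinearMap.toSpanSingleton_apply] at ha
  obtain ⟨c, hc⟩ := hc x a
  have key : φ (ε x • s₀) = algebraMap K A c • ε x • s₀ := by
    calc φ (ε x • s₀) = ε x • φ (ε x • s₀) := by rw [← map_smul, ← mul_smul, (hε.idem x).eq]
      _ = (ε x * a * ε x) • s₀ := by rw [← ha, mul_smul, mul_smul]
      _ = algebraMap K A c • ε x • s₀ := by rw [hc, Algebra.smul_def, mul_smul]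
  refine ⟨c, fun s ↦ ?_⟩
  obtain ⟨b, rfl⟩ := IsSimpleModule.toSpanSingleton_surjective A hx s
  rw [LinearMap.toSpanSingleton_apply, map_smul, key, smul_smul b, smul_smul _ b,
    Algebra.commutes]

theorem inf_sup_eq_of_corner {A : Type*} [Ring A]
    {Q : Type*} [Fintype Q] {ε : Q → A} (hε : CompleteOrthogonalIdempotents ε)
    {M : Type*} [AddCommGroup M] [Module A M]
    (h : ∀ x, ∀ u v : M, ε x • u ≠ 0 → ∃ a : A, ε x • v = a • ε x • u)
    (N L L' : Submodule A M) : N ⊓ (L ⊔ L') = (N ⊓ L) ⊔ (N ⊓ L') := by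
  refine le_antisymm (fun n hn ↦ ?_) le_inf_sup
  obtain ⟨hnN, hn⟩ := hn
  obtain ⟨l, hl, l', hl', rfl⟩ := Submodule.mem_sup.1 hn
  rw [← one_smul A (l + l'), ← hε.complete, Finset.sum_smul]
  refine sum_mem fun x _ ↦ ?_
  have hxN : ε x • (l + l') ∈ N := N.smul_mem _ hnN
  by_cases hx : ε x • l = 0
  · refine Submodule.mem_sup_right ⟨hxN, ?_⟩
    rw [smul_add, hx, zero_add]
    exact L'.smul_mem _ hl'
  · obtain ⟨a, ha⟩ := h x l (l + l') hx
    refine Submodule.mem_sup_left ⟨hxN, ?_⟩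
    rw [ha]
    exact L.smul_mem _ (L.smul_mem _ hl)

theorem exists_center_quotient_algEquiv_pi {K : Type*} [Field K] {A : Type*} [Ring A] [Algebra K A]
    {Q : Type*} [Fintype Q] {ε : Q → A} (hε : CompleteOrthogonalIdempotents ε)
    (hc : ∀ x a, ∃ c : K, ε x * a * ε x = c • ε x) (I : TwoSidedIdeal A) :
    ∃ m : ℕ, Nonempty (Subalgebra.center K I.ringCon.Quotient ≃ₐ[K] (Fin m → K)) := by
  classical
  have hq {a b : A} : (a : I.ringCon.Quotient) = b ↔ a - b ∈ I :=
    (RingCon.eq _).trans (I.rel_iff a b)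
  have hsmul {c : K} {a : A} (ha : a ∈ I) : c • a ∈ I := by
    rw [Algebra.smul_def]
    exact I.mul_mem_left _ _ ha
  have hsmul' {c : K} {a : A} (ha : c • a ∈ I) (hc0 : c ≠ 0) : a ∈ I := by
    simpa [smul_smul, inv_mul_cancel₀ hc0] using hsmul (c := c⁻¹) ha
  have hcorners {a : A} (h : ∀ x y, ε x * a * ε y ∈ I) : a ∈ I := by
    have : a = ∑ x, ∑ y, ε x * a * ε y := by
      simp_rw [← Finset.mul_sum, ← Finset.sum_mul, hε.complete, one_mul, mul_one]
    rw [this]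
    exact sum_mem fun x _ ↦ sum_mem fun y _ ↦ h x y
  let δ : (Q → K) →ₗ[K] A := Fintype.linearCombination K ε
  have hδ (g : Q → K) : δ g = ∑ x, g x • ε x := rfl
  have hεδ (x : Q) (g : Q → K) : ε x * δ g = g x • ε x := by
    simp [hδ, Finset.mul_sum, hε.mul_eq]
  have hδε (x : Q) (g : Q → K) : δ g * ε x = g x • ε x := by
    simp [hδ, Finset.sum_mul, hε.mul_eq]
  have hδmul (g h : Q → K) : δ (g * h) = δ g * δ h := by
    simp only [hδ h, Finset.mul_sum, mul_smul_comm, hδε, smul_smul]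
    simp [hδ, mul_comm]
  have hδcomm (g : Q → K) (a : A) (x y : Q) :
      ε x * (a * δ g - δ g * a) * ε y = (g y - g x) • (ε x * a * ε y) := by
    rw [mul_sub, sub_mul, ← mul_assoc, mul_assoc _ (δ g), hδε, ← mul_assoc, hεδ, sub_smul,
      mul_smul_comm, smul_mul_assoc, smul_mul_assoc]
  let Q' := {x : Q // ε x ∉ I}
  let r : Q' → Q' → Prop := fun x y ↦ ∃ a, ε x * a * ε y ∉ I
  let E : (Quot r → K) →ₗ[K] (Q → K) :=
    { toFun := fun g x ↦ if h : ε x ∉ I then g (Quot.mk r ⟨x, h⟩) else 0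
      map_add' := fun g g' ↦ by ext x; dsimp; split_ifs <;> simp
      map_smul' := fun c g ↦ by ext x; dsimp; split_ifs <;> simp }
  have hE (g : Quot r → K) (x : Q') : E g x = g (Quot.mk r x) := dif_pos x.2
  have hEmul (g g' : Quot r → K) : E (g * g') = E g * E g' := by
    ext x
    by_cases h : ε x ∈ I <;> simp [E, h]
  have hcentral (g : Quot r → K) :
      ((δ (E g) : A) : I.ringCon.Quotient) ∈ Subalgebra.center K I.ringCon.Quotient := by
    rw [Subalgebra.mem_center_iff]
    intro b
    obtain ⟨a, rfl⟩ := RingCon.mk'_surjective I.ringCon b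
    refine hq.2 (hcorners fun x y ↦ ?_)
    rw [hδcomm]
    by_cases ha : ε x * a * ε y ∈ I
    · exact hsmul ha
    · have hx : ε x ∉ I := fun h ↦ ha (by rw [mul_assoc]; exact I.mul_mem_right _ _ h)
      have hy : ε y ∉ I := fun h ↦ ha (I.mul_mem_left _ _ h)
      have : Quot.mk r ⟨x, hx⟩ = Quot.mk r ⟨y, hy⟩ := Quot.sound ⟨a, ha⟩
      rw [hE g ⟨x, hx⟩, hE g ⟨y, hy⟩, this, sub_self, zero_smul]
      exact I.zero_mem
  let Φ : (Quot r → K) →ₐ[K] Subalgebra.center K I.ringCon.Quotient := AlgHom.ofLinearMap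
    { toFun := fun g ↦ ⟨(δ (E g) : A), hcentral g⟩
      map_add' := fun g g' ↦ Subtype.ext (by simp)
      map_smul' := fun c g ↦ Subtype.ext (by simp) }
    (Subtype.ext <| hq.2 <| by
      rw [← hε.complete, hδ, ← Finset.sum_sub_distrib]
      refine sum_mem fun x _ ↦ ?_
      by_cases h : ε x ∈ I
      · exact I.sub_mem (hsmul h) h
      · simp [E, h])
    fun g g' ↦ Subtype.ext (by simp [hEmul, hδmul])
  have hΦ (g) : (Φ g : I.ringCon.Quotient) = (δ (E g) : A) := rfl
  have hinj : Function.Injective Φ := by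
    rw [injective_iff_map_eq_zero]
    intro g hg
    have hI : δ (E g) ∈ I := by
      have h0 := hΦ g
      rw [hg] at h0
      simpa using hq.1 (h0.symm.trans (RingCon.coe_zero _).symm)
    ext t
    obtain ⟨x, rfl⟩ := Quot.exists_rep t
    by_contra h
    have := I.mul_mem_left (ε x) _ hI
    rw [hεδ, hE] at this
    exact x.2 (hsmul' this h)
  have hsurj : Function.Surjective Φ := by
    rintro ⟨ζ, hζ⟩
    obtain ⟨z, rfl⟩ := RingCon.mk'_surjective I.ringCon ζ
    rw [Subalgebra.mem_center_iff] at hζ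
    have hz (a : A) : a * z - z * a ∈ I := hq.1 (hζ a)
    choose g hg using fun x ↦ hc x z
    have hzg : z - δ g ∈ I := by
      refine hcorners fun x y ↦ ?_
      rw [mul_sub, sub_mul, hεδ]
      obtain rfl | hxy := eq_or_ne x y
      · simp [hg, (hε.idem x).eq]
      · have := I.mul_mem_right _ (ε y) (hz (ε x))
        rw [sub_mul, mul_assoc z, hε.ortho hxy, mul_zero, sub_zero] at this
        simpa [hε.ortho hxy] using this
    have hg' (x y : Q') (h : r x y) : g x = g y := by
      obtain ⟨a, ha⟩ := h
      by_contra hne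
      refine ha (hsmul' (c := g y - g x) ?_ (sub_ne_zero.2 (Ne.symm hne)))
      rw [← hδcomm]
      refine I.mul_mem_right _ _ (I.mul_mem_left _ _ ?_)
      have := I.sub_mem (hz a) (I.sub_mem (I.mul_mem_left a _ hzg) (I.mul_mem_right _ a hzg))
      convert this using 1
      noncomm_ring
    refine ⟨Quot.lift (fun x ↦ g x) hg', Subtype.ext (hq.2 ?_)⟩
    have : δ (E (Quot.lift (fun x ↦ g x) hg')) - δ g ∈ I := by
      rw [hδ, hδ, ← Finset.sum_sub_distrib]
      refine sum_mem fun x _ ↦ ?_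
      by_cases h : ε x ∈ I
      · exact I.sub_mem (hsmul h) (hsmul h)
      · simp [E, h]
    have := I.sub_mem this hzg
    convert this using 1
    abel
  exact ⟨_, ⟨(AlgEquiv.ofBijective Φ ⟨hinj, hsurj⟩).symm.trans
    (AlgEquiv.piCongrLeft' K (fun _ ↦ K) (Finite.equivFin (Quot r)))⟩⟩

theorem exists_faithful_distributive {K : Type u} [Field K] {A : Type v} [Ring A] [Algebra K A]
    {Q : Type} [Fintype Q] [DecidableEq Q] {ε : Q → A} (hε : CompleteOrthogonalIdempotents ε)
    (ρ : A →ₐ[K] Matrix Q Q K) (hρ : Function.Injective ρ)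
    (hρε : ∀ x, ρ (ε x) = Matrix.single x x 1) :
    ∃ (M : Type v) (_ : AddCommGroup M) (_ : Module K M) (_ : Module A M)
      (_ : IsScalarTower K A M),
      Module.Finite K M ∧ FaithfulSMul A M ∧
        ∀ N L L' : Submodule A M, N ⊓ (L ⊔ L') = (N ⊓ L) ⊔ (N ⊓ L') := by
  have hsmall : Small.{v} (Q → K) := by
    obtain hQ | ⟨⟨x⟩⟩ := isEmpty_or_nonempty Q
    · infer_instance
    · have : Nonempty Q := ⟨x⟩
      have : Nontrivial A := ρ.toRingHom.domain_nontrivial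
      have : Small.{v} K := small_of_injective (algebraMap K A).injective
      infer_instance
  let L : Shrink.{v} (Q → K) ≃ₗ[K] (Q → K) := Shrink.linearEquiv K (Q → K)
  let F : A →+* Module.End K (Shrink.{v} (Q → K)) :=
    (L.symm.conjRingEquiv : Module.End K (Q → K) →+* Module.End K (Shrink.{v} (Q → K))).comp
      ((Matrix.toLinAlgEquiv' (R := K) (n := Q) : Matrix Q Q K →+* _).comp (ρ : A →+* _))
  let inst : Module A (Shrink.{v} (Q → K)) := Module.compHom _ F
  have hsmul (a : A) (w : Shrink.{v} (Q → K)) : a • w = L.symm ((ρ a).mulVec (L w)) := rfl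
  have hsmulε (x : Q) (w : Shrink.{v} (Q → K)) : ε x • w = L w x • L.symm (Pi.single x 1) := by
    rw [hsmul, hρε, ← map_smul]
    congr 1
    ext y
    simp [Matrix.single_mulVec, Pi.single_apply, Function.update_apply]
  have hK (c : K) (w : Shrink.{v} (Q → K)) : algebraMap K A c • w = c • w := by
    rw [hsmul, AlgHom.commutes, Algebra.algebraMap_eq_smul_one, Matrix.smul_mulVec, Matrix.one_mulVec,
      map_smul, L.symm_apply_apply]
  refine ⟨Shrink.{v} (Q → K), inferInstance, inferInstance, inst, ⟨fun c a w ↦ ?_⟩,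
    Module.Finite.equiv L.symm, ⟨fun {a b} h ↦ hρ ?_⟩, inf_sup_eq_of_corner hε fun x u v hu ↦ ?_⟩
  · rw [hsmul, hsmul, map_smul, Matrix.smul_mulVec, map_smul]
  · have h' (w : Q → K) : (ρ a).mulVec w = (ρ b).mulVec w := by
      have := h (L.symm w)
      rw [hsmul, hsmul, L.apply_symm_apply] at this
      exact L.symm.injective this
    exact Matrix.toLin'.injective (LinearMap.ext h')
  · rw [hsmulε] at hu
    have hu0 : L u x ≠ 0 := fun h ↦ hu (by rw [h, zero_smul])
    refine ⟨algebraMap K A (L v x * (L u x)⁻¹), ?_⟩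
    rw [hK, hsmulε, hsmulε, smul_smul, inv_mul_cancel_right₀ hu0]

theorem IncidenceAlgebra.exists_algHom_matrix {K : Type*} [Field K] {A : Type*} [Ring A]
    [Algebra K A] {Q : Type*} [Preorder Q] [Fintype Q] [DecidableEq Q] [LocallyFiniteOrder Q]
    (e : A ≃+* IncidenceAlgebra K Q) (he : ∀ (c : K) (a : A), e (c • a) = c • e a) :
    ∃ (ρ : A →ₐ[K] Matrix Q Q K) (ε : Q → A), Function.Injective ρ ∧
      (∀ x, ρ (ε x) = Matrix.single x x 1) := by
  let T : A →ₗ[K] Matrix Q Q K :=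
    { toFun := fun a ↦ Matrix.of fun x y ↦ e a x y
      map_add' := fun a b ↦ by ext x y; simp
      map_smul' := fun c a ↦ by ext x y; simp [he] }
  have hT (a : A) (x y : Q) : T a x y = e a x y := rfl
  let ρ : A →ₐ[K] Matrix Q Q K := AlgHom.ofLinearMap T
    (by ext x y; simp [hT, Matrix.one_apply])
    fun a b ↦ by
      ext x y
      rw [hT, map_mul, IncidenceAlgebra.mul_apply, Matrix.mul_apply]
      refine Finset.sum_subset (Finset.subset_univ _) fun z _ hz ↦ ?_
      by_contra h
      exact hz (Finset.mem_Icc.2 ⟨IncidenceAlgebra.le_of_ne_zero (left_ne_zero_of_mul h),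
        IncidenceAlgebra.le_of_ne_zero (right_ne_zero_of_mul h)⟩)
  refine ⟨ρ, fun x ↦ e.symm ⟨fun z w ↦ if x = z ∧ x = w then 1 else 0, ?_⟩, ?_, ?_⟩
  · intro a b hab
    refine if_neg ?_
    rintro ⟨rfl, rfl⟩
    exact hab le_rfl
  · intro a b hab
    refine e.injective (IncidenceAlgebra.ext fun x y _ ↦ congr_fun₂ hab x y)
  · intro x
    ext z w
    change e (e.symm _) z w = _
    rw [e.apply_symm_apply, Matrix.single_apply]
    rfl

theorem exists_corner_of_algHom_matrix {K : Type*} [Field K] {A : Type*} [Ring A]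
    [Algebra K A] {Q : Type*} [Fintype Q] [DecidableEq Q] {ε : Q → A}
    (ρ : A →ₐ[K] Matrix Q Q K) (hρ : Function.Injective ρ)
    (hρε : ∀ x, ρ (ε x) = Matrix.single x x 1) :
    CompleteOrthogonalIdempotents ε ∧ ∀ x a, ∃ c : K, ε x * a * ε x = c • ε x := by
  refine ⟨⟨⟨fun x ↦ hρ ?_, fun x y hxy ↦ hρ ?_⟩, hρ ?_⟩, fun x a ↦ ⟨ρ a x x, hρ ?_⟩⟩
  · simp [hρε]
  · simp [hρε, hxy]
  · ext x y
    simp [hρε, Matrix.sum_apply, Matrix.single_apply, Matrix.one_apply, ite_and]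
  · simp [hρε]

theorem feinberg_characterization
    (K : Type u) [Field K] [Infinite K]
    (A : Type v) [Ring A] [Algebra K A] [FiniteDimensional K A] :
    (∃ (Q : Type) (_ : Preorder Q) (_ : Fintype Q) (_ : DecidableEq Q)
        (_ : LocallyFiniteOrder Q) (e : A ≃+* IncidenceAlgebra K Q),
        ∀ (c : K) (a : A), e (c • a) = c • e a) ↔
      ((∃ (M : Type v) (_ : AddCommGroup M) (_ : Module K M) (_ : Module A M)
          (_ : IsScalarTower K A M),
          Module.Finite K M ∧ FaithfulSMul A M ∧
            ∀ N L L' : Submodule A M, N ⊓ (L ⊔ L') = (N ⊓ L) ⊔ (N ⊓ L')) ∧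
       (∀ (S : Type v) [AddCommGroup S] [Module A S], IsSimpleModule A S →
          ∀ φ : S →ₗ[A] S, ∃ c : K, ∀ x : S, φ x = algebraMap K A c • x) ∧
       (∀ I : TwoSidedIdeal A, ∃ m : ℕ,
          Nonempty (Subalgebra.center K I.ringCon.Quotient ≃ₐ[K] (Fin m → K)))) := by
  constructor
  · rintro ⟨Q, _, _, _, _, e, he⟩
    obtain ⟨ρ, ε, hρ, hρε⟩ := IncidenceAlgebra.exists_algHom_matrix e he
    obtain ⟨hε, hc⟩ := exists_corner_of_algHom_matrix ρ hρ hρε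
    exact ⟨exists_faithful_distributive hε ρ hρ hρε,
      fun S _ _ _ φ ↦ exists_end_eq_smul_of_corner hε hc φ,
      exists_center_quotient_algEquiv_pi hε hc⟩
  · rintro ⟨⟨M, _, _, _, _, -, _, hM⟩, hsimple, hcenter⟩
    have hred (I : Ideal A) (hI : I.IsTwoSided) (z : A) (hz : ∀ a, a * z - z * a ∈ I)
        (hz2 : z * z ∈ I) : z ∈ I := by
      obtain ⟨m, ⟨f⟩⟩ := hcenter I.toTwoSided
      rw [← Ideal.mem_toTwoSided]
      exact mem_of_center_quotient_algEquiv_pi _ f (fun a ↦ Ideal.mem_toTwoSided.2 (hz a))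
        (Ideal.mem_toTwoSided.2 hz2)
    obtain ⟨n, d, π, hπ, hnil⟩ := exists_surjective_pi_matrix_of_forall_end_eq_smul K A hsimple
    obtain ⟨e, he, he0, hcorner⟩ := exists_completeOrthogonalIdempotents_corner hred π hπ hnil
    have hw (x) : ∃ w : M, e x • w ≠ 0 := by
      by_contra! h
      exact he0 x (eq_of_smul_eq_smul fun w : M ↦ by rw [h, zero_smul])
    choose w hw using hw
    have hem (x) : e x • e x • w x = e x • w x := by rw [← mul_smul, (he.idem x).eq]
    obtain ⟨hpre, hdec, hloc, f, hf⟩ := exists_incidenceAlgebra_equiv he hw hem fun x v hv ↦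
      exists_smul_eq_of_distributive hM (hcorner x) (hem x) hv (hw x)
    exact ⟨_, hpre, inferInstance, hdec, hloc, f, hf⟩
end

section
/- Let K be an infinite field and A a finite-dimensional K-algebra such that every simple A-module is 1-dimensional over K. Then every nonzero finite-dimensional indecomposable thin A-module is accessible. -/
/-!
STATEMENT 19: Let `K` be an infinite field and `A` a finite-dimensional `K`-algebra
all of whose simple modules are 1-dimensional over `K`.  Then every nonzero
finite-dimensional indecomposable thin `A`-module is accessible.

Accessibility is defined inductively: simple modules are accessible, and an
indecomposable module `M` of length `n > 1` is accessible if it has an indecomposable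
accessible submodule of length `n − 1` (i.e. a submodule with simple quotient) or an
indecomposable accessible quotient of length `n − 1` (i.e. a quotient by a simple
submodule).
-/

universe u v w

/-- A module is indecomposable if it is nonzero and is not the internal direct sum of
two nonzero submodules. -/
def IsIndecomposableModule (R : Type u) [Ring R] (M : Type v) [AddCommGroup M]
    [Module R M] : Prop :=
  Nontrivial M ∧ ∀ N N' : Submodule R M, IsCompl N N' → N = ⊥ ∨ N' = ⊥

/-- A module is thin (squarefree) if it has finite length and no chain
`N₀ ≤ N₁ ≤ N₂ ≤ N₃` of submodules has `N₁/N₀` and `N₃/N₂` simple and isomorphic. -/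
def IsThinModule (R : Type u) [Ring R] (M : Type v) [AddCommGroup M] [Module R M] : Prop :=
  IsFiniteLength R M ∧
    ∀ N₀ N₁ N₂ N₃ : Submodule R M, N₀ ≤ N₁ → N₁ ≤ N₂ → N₂ ≤ N₃ →
      IsSimpleModule R (↥N₁ ⧸ Submodule.comap N₁.subtype N₀) →
      IsSimpleModule R (↥N₃ ⧸ Submodule.comap N₃.subtype N₂) →
      IsEmpty ((↥N₁ ⧸ Submodule.comap N₁.subtype N₀) ≃ₗ[R]
        (↥N₃ ⧸ Submodule.comap N₃.subtype N₂))

/-- Accessible modules: simple modules are accessible, and an indecomposable module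
is accessible if it has an indecomposable accessible submodule of colength one
(simple quotient) or an indecomposable accessible quotient by a simple submodule. -/
inductive IsAccessible (A : Type u) [Ring A] :
    ∀ (M : Type v) [AddCommGroup M] [Module A M], Prop where
  | of_simple {M : Type v} [AddCommGroup M] [Module A M] :
      IsSimpleModule A M → IsAccessible A M
  | of_submodule {M : Type v} [AddCommGroup M] [Module A M] (N : Submodule A M) :
      IsIndecomposableModule A M → IsSimpleModule A (M ⧸ N) →
      IsIndecomposableModule A ↥N → IsAccessible A ↥N → IsAccessible A M
  | of_quotient {M : Type v} [AddCommGroup M] [Module A M] (N : Submodule A M) :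
      IsIndecomposableModule A M → IsSimpleModule A ↥N →
      IsIndecomposableModule A (M ⧸ N) → IsAccessible A (M ⧸ N) → IsAccessible A M

/-- An element of a poset is extremal if it is minimal or maximal. -/
def IsExtremal {P : Type*} [LE P] (x : P) : Prop := IsMin x ∨ IsMax x

theorem exists_isMin_le {P : Type*} [PartialOrder P] [Finite P] (x : P) :
    ∃ m ≤ x, IsMin m := by
  obtain ⟨m, hm, h⟩ := Set.finite_univ.exists_le_minimal (Set.mem_univ x)
  exact ⟨m, hm, fun y hy => h.2 (Set.mem_univ y) hy⟩

theorem exists_isMax_ge {P : Type*} [PartialOrder P] [Finite P] (x : P) :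
    ∃ m ≥ x, IsMax m := by
  obtain ⟨m, hm, h⟩ := Set.finite_univ.exists_le_maximal (Set.mem_univ x)
  exact ⟨m, hm, fun y hy => h.2 (Set.mem_univ y) hy⟩

/-- The comparability graph on the minimal and maximal elements of a poset. -/
def extremalGraph (P : Type*) [PartialOrder P] : SimpleGraph {x : P // IsExtremal x} where
  Adj x y := x < y ∨ y < x
  symm := ⟨fun _ _ h => h.symm⟩
  loopless := ⟨fun x h => h.elim (lt_irrefl x) (lt_irrefl x)⟩

theorem extremalGraph_reachable_of_le {P : Type*} [PartialOrder P]
    {x y : {x : P // IsExtremal x}} (h : x ≤ y) : (extremalGraph P).Reachable x y := by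
  rcases h.eq_or_lt with rfl | h
  · rfl
  · exact SimpleGraph.Adj.reachable (Or.inl h)

theorem extremalGraph_connected {P : Type*} [PartialOrder P] [Finite P] [Nonempty P]
    (hP : ∀ s : Set P, IsLowerSet s → IsUpperSet s → s.Nonempty → s = Set.univ) :
    (extremalGraph P).Connected := by
  have : Nonempty {x : P // IsExtremal x} :=
    (exists_isMin_le (Classical.arbitrary P)).elim fun m hm => ⟨⟨m, Or.inl hm.2⟩⟩
  refine ⟨fun b x => ?_⟩
  set U : Set P := {y | ∃ m : {x : P // IsExtremal x}, (extremalGraph P).Reachable b m ∧ m.1 ≤ y}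
  have hU : U = Set.univ := by
    refine hP U ?_ ?_ ⟨b.1, b, .rfl, le_rfl⟩
    · rintro y z hzy ⟨m, hbm, hmy⟩
      obtain ⟨n, hnz, hn⟩ := exists_isMin_le z
      obtain ⟨t, hyt, ht⟩ := exists_isMax_ge y
      refine ⟨⟨n, Or.inl hn⟩, ?_, hnz⟩
      have h₁ : (extremalGraph P).Reachable m ⟨t, Or.inr ht⟩ :=
        extremalGraph_reachable_of_le (hmy.trans hyt)
      have h₂ : (extremalGraph P).Reachable ⟨n, Or.inl hn⟩ ⟨t, Or.inr ht⟩ :=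
        extremalGraph_reachable_of_le (hnz.trans (hzy.trans hyt))
      exact (hbm.trans h₁).trans h₂.symm
    · rintro y z hyz ⟨m, hbm, hmy⟩
      exact ⟨m, hbm, hmy.trans hyz⟩
  obtain ⟨m, hbm, hmx⟩ : x.1 ∈ U := hU ▸ Set.mem_univ _
  exact hbm.trans (extremalGraph_reachable_of_le hmx)

/-- A finite connected poset with at least two elements has an extremal element `v` whose
removal leaves the comparability graph on the other extremal elements connected. -/
theorem exists_isExtremal_forall_mem {P : Type*} [PartialOrder P] [Finite P] [Nontrivial P]
    (hP : ∀ s : Set P, IsLowerSet s → IsUpperSet s → s.Nonempty → s = Set.univ) :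
    ∃ v : P, IsExtremal v ∧ ∀ T : Set P,
      (∀ x y, IsExtremal x → IsExtremal y → x ≠ v → y ≠ v → x ≤ y → (x ∈ T ↔ y ∈ T)) →
      ∀ x y, IsExtremal x → IsExtremal y → x ≠ v → y ≠ v → x ∈ T → y ∈ T := by
  have hnt : Nontrivial {x : P // IsExtremal x} := by
    by_contra h
    rw [not_nontrivial_iff_subsingleton] at h
    obtain ⟨x, y, hxy⟩ := exists_pair_ne P
    obtain ⟨b, hb, hb'⟩ := exists_isMin_le x
    have key : ∀ z, z = b := fun z => by
      obtain ⟨m, hm, hm'⟩ := exists_isMin_le z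
      obtain ⟨n, hn, hn'⟩ := exists_isMax_ge z
      have h₁ : m = b := congrArg Subtype.val
        (Subsingleton.elim (⟨m, Or.inl hm'⟩ : {x : P // IsExtremal x}) ⟨b, Or.inl hb'⟩)
      have h₂ : n = b := congrArg Subtype.val
        (Subsingleton.elim (⟨n, Or.inr hn'⟩ : {x : P // IsExtremal x}) ⟨b, Or.inl hb'⟩)
      exact le_antisymm (h₂ ▸ hn) (h₁ ▸ hm)
    exact hxy ((key x).trans (key y).symm)
  obtain ⟨v, hv⟩ :=
    (extremalGraph_connected hP).exists_connected_induce_compl_singleton_of_finite_nontrivial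
  refine ⟨v.1, v.2, fun T hT x y hx hy hxv hyv hxT => ?_⟩
  obtain ⟨w⟩ := hv.preconnected ⟨⟨x, hx⟩, fun h => hxv (congrArg Subtype.val h)⟩
    ⟨⟨y, hy⟩, fun h => hyv (congrArg Subtype.val h)⟩
  have step : ∀ a b, ((extremalGraph P).induce {v}ᶜ).Walk a b → a.1.1 ∈ T → b.1.1 ∈ T := by
    intro a b w
    induction w with
    | nil => exact id
    | @cons a b c h _ ih =>
      intro ha
      have hav : a.1.1 ≠ v.1 := fun h => a.2 (Subtype.ext h)
      have hbv : b.1.1 ≠ v.1 := fun h => b.2 (Subtype.ext h)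
      refine ih ?_
      rcases h with h | h
      · exact (hT _ _ a.1.2 b.1.2 hav hbv h.le).1 ha
      · exact (hT _ _ b.1.2 a.1.2 hbv hav h.le).2 ha
  exact step _ _ w hxT

/-- A finite connected lattice of lower sets with a proper element has a coatom `c` such that
`[⊥, c]` admits no nontrivial decomposition, or an atom `c` such that `[c, ⊤]` admits none. -/
theorem LowerSet.exists_coatom_or_atom {P : Type*} [PartialOrder P] [Finite P]
    (hP : ∀ a b : LowerSet P, IsCompl a b → a = ⊥ ∨ b = ⊥)
    (hne : ∃ a : LowerSet P, a ≠ ⊥ ∧ a ≠ ⊤) :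
    (∃ c : LowerSet P, IsCoatom c ∧ ∀ a b, a ⊔ b = c → a ⊓ b = ⊥ → a = ⊥ ∨ b = ⊥) ∨
    (∃ c : LowerSet P, IsAtom c ∧ ∀ a b, a ⊓ b = c → a ⊔ b = ⊤ → a = c ∨ b = c) := by
  have hnt : Nontrivial P := by
    obtain ⟨a, ha, ha'⟩ := hne
    obtain ⟨x, hx⟩ : ∃ x, x ∈ a := by
      by_contra! h
      exact ha (LowerSet.ext (Set.eq_empty_of_forall_notMem h))
    obtain ⟨y, hy⟩ : ∃ y, y ∉ a := by
      by_contra! h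
      exact ha' (LowerSet.ext (Set.eq_univ_of_forall h))
    exact ⟨x, y, fun h => hy (h ▸ hx)⟩
  have hconn : ∀ s : Set P, IsLowerSet s → IsUpperSet s → s.Nonempty → s = Set.univ := by
    intro s hl hu hs
    have hcompl : IsCompl (⟨s, hl⟩ : LowerSet P) ⟨sᶜ, hu.compl⟩ :=
      ⟨disjoint_iff.2 (LowerSet.ext (Set.inter_compl_self s)),
        codisjoint_iff.2 (LowerSet.ext (Set.union_compl_self s))⟩
    rcases hP _ _ hcompl with h | h
    · exact absurd (congrArg LowerSet.carrier h) hs.ne_empty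
    · exact Set.compl_empty_iff.1 (congrArg LowerSet.carrier h)
  have hnonempty : ∀ a : LowerSet P, a ≠ ⊥ → ∃ x ∈ a, IsMin x := by
    intro a ha
    obtain ⟨x, hx⟩ : ∃ x, x ∈ a := by
      by_contra! h
      exact ha (LowerSet.ext (Set.eq_empty_of_forall_notMem h))
    obtain ⟨m, hm, hm'⟩ := exists_isMin_le x
    exact ⟨m, a.lower hm hx, hm'⟩
  obtain ⟨v, hv, hvT⟩ := exists_isExtremal_forall_mem hconn
  rcases hv with hv | hv
  · right
    have hmem : ∀ {x}, x ∈ LowerSet.Iic v ↔ x = v :=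
      fun {x} => ⟨fun h => le_antisymm h (hv h), fun h => h.le⟩
    refine ⟨LowerSet.Iic v, ⟨?_, ?_⟩, fun a b hinf hsup => ?_⟩
    · intro h
      have : v ∈ (⊥ : LowerSet P) := h ▸ LowerSet.mem_Iic_iff.2 le_rfl
      exact this
    · intro b hb
      by_contra hb'
      obtain ⟨x, hx, -⟩ := hnonempty b hb'
      refine hb.not_ge (LowerSet.Iic_le.2 ?_)
      exact hmem.1 (hb.le hx) ▸ hx
    · have hab : ∀ x, x ∈ a ∨ x ∈ b := fun x => by
        have : x ∈ a ⊔ b := hsup ▸ LowerSet.mem_top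
        exact LowerSet.mem_sup_iff.1 this
      have hv' : ∀ x, x ∈ a → x ∈ b → x = v := fun x hxa hxb =>
        hmem.1 (hinf ▸ LowerSet.mem_inf_iff.2 ⟨hxa, hxb⟩)
      have hva : v ∈ a ⊓ b := hinf ▸ LowerSet.mem_Iic_iff.2 le_rfl
      have hsep : ∀ s : LowerSet P, v ∈ s → s ≠ LowerSet.Iic v → ∃ x ∈ s, x ≠ v := by
        intro s hvs hs
        by_contra! h
        exact hs (le_antisymm (fun x hx => hmem.2 (h x hx)) (LowerSet.Iic_le.2 hvs))
      by_contra! hne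
      obtain ⟨x, hx, hxv⟩ := hsep a hva.1 hne.1
      obtain ⟨y, hy, hyv⟩ := hsep b hva.2 hne.2
      obtain ⟨x', hx', hx''⟩ := exists_isMax_ge x
      obtain ⟨y', hy', hy''⟩ := exists_isMax_ge y
      have hx'v : x' ≠ v := fun h => hxv (hmem.1 (LowerSet.mem_Iic_iff.2 (h ▸ hx')))
      have hy'v : y' ≠ v := fun h => hyv (hmem.1 (LowerSet.mem_Iic_iff.2 (h ▸ hy')))
      have hx'b : x' ∉ b := fun h => hxv (hv' x hx (b.lower hx' h))
      have hy'a : y' ∉ a := fun h => hyv (hv' y (a.lower hy' h) hy)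
      refine hy'a (hvT (a : Set P) ?_ x' y' (.inr hx'') (.inr hy'') hx'v hy'v
        ((hab x').resolve_right hx'b))
      exact fun p q _ _ hp _ hpq => ⟨fun h => (hab q).resolve_right fun hq =>
        hp (hv' p h (b.lower hpq hq)), fun h => a.lower hpq h⟩
  · left
    have hc : ∀ x, x ∈ (UpperSet.Ici v).compl ↔ x ≠ v := fun x => by
      rw [UpperSet.mem_compl_iff, UpperSet.mem_Ici_iff, not_iff_not]
      exact ⟨fun h => le_antisymm (hv h) h, fun h => h.ge⟩
    refine ⟨(UpperSet.Ici v).compl, ⟨?_, ?_⟩, fun a b hsup hinf => ?_⟩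
    · intro h
      have : v ∈ (UpperSet.Ici v).compl := h ▸ LowerSet.mem_top
      exact (hc v).1 this rfl
    · intro b hb
      obtain ⟨x, hx, hx'⟩ := Set.exists_of_ssubset (LowerSet.coe_ssubset_coe.2 hb)
      have hxv : x = v := not_not.1 fun h => hx' ((hc x).2 h)
      refine LowerSet.ext (Set.eq_univ_of_forall fun y => ?_)
      by_cases hy : y = v
      · exact hy ▸ hxv ▸ hx
      · exact hb.le ((hc y).2 hy)
    · by_contra! hne
      obtain ⟨x, hx, hx'⟩ := hnonempty a hne.1
      obtain ⟨y, hy, hy'⟩ := hnonempty b hne.2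
      have hab : ∀ z, z ≠ v ↔ z ∈ a ∨ z ∈ b := fun z => by
        rw [← hc, ← hsup, LowerSet.mem_sup_iff]
      have hdisj : ∀ z, z ∈ a → z ∉ b := fun z ha hb => by
        have : z ∈ (⊥ : LowerSet P) := hinf ▸ LowerSet.mem_inf_iff.2 ⟨ha, hb⟩
        exact this
      refine hdisj y (hvT (a : Set P) ?_ x y (.inl hx') (.inl hy') ((hab x).2 (.inl hx))
        ((hab y).2 (.inr hy)) hx) hy
      exact fun p q _ _ _ hq hpq => ⟨fun h => ((hab q).1 hq).resolve_right fun hq =>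
        hdisj p h (b.lower hpq hq), fun h => a.lower hpq h⟩

theorem exists_coatom_or_atom_of_distribLattice {L : Type*} [DistribLattice L] [BoundedOrder L]
    [Finite L] (hL : ∀ a b : L, IsCompl a b → a = ⊥ ∨ b = ⊥) (hne : ∃ a : L, a ≠ ⊥ ∧ a ≠ ⊤) :
    (∃ c : L, IsCoatom c ∧ ∀ a b, a ⊔ b = c → a ⊓ b = ⊥ → a = ⊥ ∨ b = ⊥) ∨
    (∃ c : L, IsAtom c ∧ ∀ a b, a ⊓ b = c → a ⊔ b = ⊤ → a = c ∨ b = c) := by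
  have := Fintype.ofFinite L
  have : DecidablePred (SupIrred (α := L)) := Classical.decPred _
  let e := OrderIso.lowerSetSupIrred (α := L)
  have h := LowerSet.exists_coatom_or_atom (P := {a : L // SupIrred a})
    (fun a b hab => by simpa using! hL (e.symm a) (e.symm b) (e.symm.isCompl hab))
    (by
      obtain ⟨a, ha, ha'⟩ := hne
      exact ⟨e a, by simpa using! ha, by simpa using! ha'⟩)
  refine h.imp ?_ ?_
  · rintro ⟨c, hc, h⟩
    refine ⟨e.symm c, (e.symm.isCoatom_iff c).2 hc, fun a b hs hi => ?_⟩
    simpa using! h (e a) (e b) (by rw [← map_sup, hs, e.apply_symm_apply])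
      (by rw [← map_inf, hi, map_bot])
  · rintro ⟨c, hc, h⟩
    refine ⟨e.symm c, (e.symm.isAtom_iff c).2 hc, fun a b hi hs => ?_⟩
    have := h (e a) (e b) (by rw [← map_inf, hi, e.apply_symm_apply])
      (by rw [← map_sup, hs, map_top])
    rwa [← e.eq_symm_apply, ← e.eq_symm_apply] at this

theorem finite_of_distribLattice {L : Type*} [DistribLattice L] [BoundedOrder L]
    [WellFoundedLT L] [WellFoundedGT L] : Finite L := by
  have key : ∀ x : L, (Set.Iic x).Finite := by
    intro x
    induction x using WellFoundedLT.induction with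
    | ind x ih =>
      rcases eq_bot_or_bot_lt x with rfl | hx
      · simp
      · obtain ⟨c, -, hc⟩ := exists_le_covBy_of_lt hx
        refine Set.Finite.of_finite_image (f := fun y => (y ⊓ c, y ⊔ c))
          (((ih c hc.lt).prod (Set.toFinite {c, x})).subset ?_) ?_
        · rintro _ ⟨y, hy, rfl⟩
          exact ⟨Set.mem_Iic.2 inf_le_right, hc.eq_or_eq le_sup_right (sup_le hy hc.le)⟩
        · intro y _ z _ h
          exact eq_of_inf_eq_sup_eq (congrArg Prod.fst h) (congrArg Prod.snd h)
  exact Set.finite_univ_iff.1 (Set.Iic_top (α := L) ▸ key ⊤)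


theorem nonempty_quotient_equiv_of_inf_eq_of_sup_eq {R M : Type*} [Ring R] [AddCommGroup M]
    [Module R M] {p q a t : Submodule R M} (ha : p ⊓ q = a) (ht : p ⊔ q = t) :
    Nonempty ((↥p ⧸ Submodule.comap p.subtype a) ≃ₗ[R] (↥t ⧸ Submodule.comap t.subtype q)) := by
  subst ha ht
  exact ⟨LinearMap.quotientInfEquivSupQuotient p q⟩

/-- If `x ⊓ (y ⊔ z) ≤ (x ⊓ y) ⊔ (x ⊓ z)` fails, then a simple module between the two sides is
isomorphic to a simple subquotient of `(x ⊔ y) / x`. -/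
theorem IsThinModule.inf_sup_le {R : Type*} [Ring R] {M : Type*} [AddCommGroup M] [Module R M]
    (h : IsThinModule R M) (x y z : Submodule R M) : x ⊓ (y ⊔ z) ≤ (x ⊓ y) ⊔ (x ⊓ z) := by
  obtain ⟨_, _⟩ := isFiniteLength_iff_isNoetherian_isArtinian.1 h.1
  by_contra hle
  set d := (x ⊓ y) ⊔ (x ⊓ z) with hd
  obtain ⟨n, hdn, hn⟩ := exists_covBy_le_of_lt (lt_of_le_not_ge (le_inf_sup (a := x)) hle)
  change d ⋖ n at hdn
  have hnx : n ≤ x := hn.trans inf_le_left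
  have hnz : n ⊓ z ≤ d := (inf_le_inf_right z hnx).trans le_sup_right
  set q := d ⊔ z with hq
  set y₁ := (n ⊔ z) ⊓ y with hy₁
  set y₀ := y ⊓ q with hy₀
  have hqn : q ≤ n ⊔ z := sup_le_sup_right hdn.le z
  have hqy : q = (x ⊓ y) ⊔ z :=
    le_antisymm (sup_le (sup_le le_sup_left (inf_le_right.trans le_sup_right)) le_sup_right)
      (sup_le_sup_right le_sup_left z)
  have hy₀₁ : y₀ ≤ y₁ := le_inf (inf_le_right.trans hqn) inf_le_left
  have hy₁z : y₁ ⊔ z = n ⊔ z := by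
    rw [hy₁, inf_sup_assoc_of_le y (le_sup_right : z ≤ n ⊔ z)]
    exact inf_eq_left.2 (sup_le (hn.trans inf_le_right) le_sup_right)
  have e₁ := nonempty_quotient_equiv_of_inf_eq_of_sup_eq (p := n) (q := q) (a := d) (t := n ⊔ z)
    (by rw [hq, inf_comm, sup_inf_assoc_of_le z hdn.le, inf_comm z n, sup_eq_left.2 hnz])
    (by rw [hq, ← sup_assoc, sup_eq_left.2 hdn.le])
  have e₂ := nonempty_quotient_equiv_of_inf_eq_of_sup_eq (p := y₁) (q := q) (a := y₀) (t := n ⊔ z)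
    (by rw [hy₁, hy₀, inf_assoc, inf_eq_right.2 (inf_le_right.trans hqn)])
    (le_antisymm (sup_le inf_le_left hqn) (hy₁z ▸ sup_le_sup_left le_sup_right y₁))
  have e₃ := nonempty_quotient_equiv_of_inf_eq_of_sup_eq (p := y₁) (q := y₀ ⊔ x) (a := y₀)
    (t := y₁ ⊔ x)
    (by
      have : x ⊓ y₁ ≤ y₀ := le_inf (inf_le_right.trans inf_le_right)
        ((inf_le_inf_left x inf_le_right).trans (hqy ▸ le_sup_left))
      rw [inf_comm, sup_inf_assoc_of_le x hy₀₁, sup_eq_left.2 this])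
    (by rw [← sup_assoc, sup_eq_left.2 hy₀₁])
  obtain ⟨e₁⟩ := e₁
  obtain ⟨e₂⟩ := e₂
  obtain ⟨e₃⟩ := e₃
  let e := (e₁.trans e₂.symm).trans e₃
  have hs := (covBy_iff_quot_is_simple hdn.le).1 hdn
  exact (h.2 d n (y₀ ⊔ x) (y₁ ⊔ x) hdn.le (hnx.trans le_sup_right) (sup_le_sup_right hy₀₁ x) hs
    (IsSimpleModule.congr e.symm)).false e

theorem isIndecomposableModule_submodule {R : Type*} [Ring R] {M : Type*} [AddCommGroup M]
    [Module R M] {N : Submodule R M} (hN : N ≠ ⊥)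
    (h : ∀ a b : Submodule R M, a ⊔ b = N → a ⊓ b = ⊥ → a = ⊥ ∨ b = ⊥) :
    IsIndecomposableModule R N := by
  refine ⟨Submodule.nontrivial_iff_ne_bot.2 hN, fun a b hab => ?_⟩
  have := h (a.map N.subtype) (b.map N.subtype)
    (by rw [← Submodule.map_sup, hab.sup_eq_top, Submodule.map_subtype_top])
    (by rw [← Submodule.map_inf _ N.injective_subtype, hab.inf_eq_bot, Submodule.map_bot])
  have hbot : ∀ c : Submodule R N, c.map N.subtype = ⊥ → c = ⊥ := fun c hc =>
    Submodule.map_injective_of_injective N.injective_subtype (hc.trans (Submodule.map_bot _).symm)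
  exact this.imp (hbot a) (hbot b)

theorem isIndecomposableModule_quotient {R : Type*} [Ring R] {M : Type*} [AddCommGroup M]
    [Module R M] {N : Submodule R M} (hN : N ≠ ⊤)
    (h : ∀ a b : Submodule R M, a ⊓ b = N → a ⊔ b = ⊤ → a = N ∨ b = N) :
    IsIndecomposableModule R (M ⧸ N) := by
  refine ⟨Submodule.Quotient.nontrivial_iff.2 hN, fun a b hab => ?_⟩
  have hbot : ∀ c : Submodule R (M ⧸ N), c.comap N.mkQ = N → c = ⊥ := fun c hc =>
    Submodule.comap_injective_of_surjective N.mkQ_surjective (by simpa using hc)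
  have hsup : a.comap N.mkQ ⊔ b.comap N.mkQ = ⊤ := by
    have hmap : (a.comap N.mkQ ⊔ b.comap N.mkQ).map N.mkQ = ⊤ := by
      rw [Submodule.map_sup, Submodule.map_comap_eq_of_surjective N.mkQ_surjective,
        Submodule.map_comap_eq_of_surjective N.mkQ_surjective, hab.sup_eq_top]
    rw [← sup_eq_right.2 ((N.le_comap_mkQ a).trans le_sup_left), ← Submodule.comap_map_mkQ, hmap,
      Submodule.comap_top]
  have := h (a.comap N.mkQ) (b.comap N.mkQ)
    (by rw [← Submodule.comap_inf, hab.inf_eq_bot, Submodule.comap_bot, N.ker_mkQ])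
    hsup
  exact this.imp (hbot a) (hbot b)

/-- An indecomposable module whose submodule lattice is finite and distributive is accessible. -/
theorem isAccessible_of_finite_of_inf_sup_le {A : Type*} [Ring A] (n : ℕ) :
    ∀ (M : Type w) [AddCommGroup M] [Module A M] [Finite (Submodule A M)],
      (∀ x y z : Submodule A M, x ⊓ (y ⊔ z) ≤ (x ⊓ y) ⊔ (x ⊓ z)) →
      IsIndecomposableModule A M → Nat.card (Submodule A M) = n → IsAccessible A M := by
  induction n using Nat.strong_induction_on with
  | _ n ih =>
  intro M _ _ _ hd hM hn
  have := hM.1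
  by_cases hne : ∃ a : Submodule A M, a ≠ ⊥ ∧ a ≠ ⊤
  swap
  · push Not at hne
    exact .of_simple (isSimpleModule_iff A M |>.2 ⟨fun a => or_iff_not_imp_left.2 (hne a)⟩)
  let _ : DistribLattice (Submodule A M) := .ofInfSupLe hd
  rcases exists_coatom_or_atom_of_distribLattice hM.2 hne with ⟨N, hN, h⟩ | ⟨N, hN, h⟩
  · have hN₀ : N ≠ ⊥ := by
      rintro rfl
      obtain ⟨a, ha, ha'⟩ := hne
      exact ha' (hN.2 a (bot_lt_iff_ne_bot.2 ha))
    have hind := isIndecomposableModule_submodule hN₀ h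
    have : Finite (Submodule A N) := Finite.of_equiv _ N.mapIic.symm.toEquiv
    refine .of_submodule N hM (isSimpleModule_iff_isCoatom.2 hN) hind (ih _ ?_ N ?_ hind rfl)
    · rw [← hn, Nat.card_congr N.mapIic.toEquiv]
      exact Finite.card_subtype_lt (x := ⊤) fun h : ⊤ ≤ N => hN.1 (top_le_iff.1 h)
    · intro x y z
      rw [← Submodule.map_le_map_iff_of_injective N.injective_subtype]
      simpa only [Submodule.map_inf _ N.injective_subtype, Submodule.map_sup] using hd _ _ _
  · have hN₁ : N ≠ ⊤ := by
      rintro rfl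
      obtain ⟨a, ha, ha'⟩ := hne
      exact ha (hN.2 a (lt_top_iff_ne_top.2 ha'))
    have hind := isIndecomposableModule_quotient hN₁ h
    have : Finite (Submodule A (M ⧸ N)) := Finite.of_equiv _ N.comapMkQRelIso.symm.toEquiv
    refine .of_quotient N hM (isSimpleModule_iff_isAtom.2 hN) hind (ih _ ?_ (M ⧸ N) ?_ hind rfl)
    · rw [← hn, Nat.card_congr N.comapMkQRelIso.toEquiv]
      exact Finite.card_subtype_lt (x := ⊥) fun h : N ≤ ⊥ => hN.1 (le_bot_iff.1 h)
    · intro x y z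
      let e := N.comapMkQRelIso
      refine e.le_iff_le.1 ?_
      rw [map_inf, map_sup, map_sup, map_inf, map_inf]
      exact hd _ _ _

theorem isAccessible_of_indecomposable_thin
    (K : Type u) [Field K] [Infinite K]
    (A : Type v) [Ring A] [Algebra K A] [FiniteDimensional K A]
    (hpointed : ∀ (S : Type w) [AddCommGroup S] [Module K S] [Module A S]
      [IsScalarTower K A S], IsSimpleModule A S → Module.finrank K S = 1)
    (M : Type w) [AddCommGroup M] [Module K M] [Module A M] [IsScalarTower K A M]
    [Module.Finite K M] [Nontrivial M]
    (hindec : IsIndecomposableModule A M) (hthin : IsThinModule A M) :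
    IsAccessible A M := by
  obtain ⟨_, _⟩ := isFiniteLength_iff_isNoetherian_isArtinian.1 hthin.1
  have hd := hthin.inf_sup_le
  have : Finite (Submodule A M) :=
    let _ : DistribLattice (Submodule A M) := .ofInfSupLe hd
    finite_of_distribLattice
  exact isAccessible_of_finite_of_inf_sup_le _ M hd hindec rfl
end
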